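/- Let A and B be k-algebras and let φ: A[s1,...,sn] → B[t1,...,tn] be a k-algebra isomorphism between polynomial extensions. If φ(Z(A)) ⊆ B, then A and B are isomorphic as k-algebras. -/

import Mathlib

open scoped TensorProduct

universe u

/-- The polynomial extension `A[t₁,…,tₙ]` of a (possibly noncommutative) `k`-algebra `A`
in `n` central, mutually commuting indeterminates. -/
abbrev PolyExt (A : Type u) [Ring A] (n : ℕ) : Type u :=
  AddMonoidAlgebra A (Fin n →₀ ℕ)

/-- The canonical embedding `A → A[t₁,…,tₙ]` as constant polynomials. -/
noncomputable def PolyExt.C (k A : Type u) [Field k] [Ring A] [Algebra k A] (n : ℕ) :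
    A →ₐ[k] PolyExt A n :=
  AddMonoidAlgebra.singleZeroAlgHom

/-- The `i`-th indeterminate of `A[t₁,…,tₙ]`. -/
noncomputable def PolyExt.X (A : Type u) [Ring A] (n : ℕ) (i : Fin n) : PolyExt A n :=
  AddMonoidAlgebra.single (Finsupp.single i 1) 1

/-- Two rings are Morita equivalent if their categories of right modules are
equivalent (as abelian categories). -/
def MoritaEquivalent (R S : Type u) [Ring R] [Ring S] : Prop :=
  Nonempty (ModuleCat.{u} Rᵐᵒᵖ ≌ ModuleCat.{u} Sᵐᵒᵖ)

/-- `A` is strongly cancellative: for every `n ≥ 1` and every `k`-algebra `B`, any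
`k`-algebra isomorphism `A[s₁,…,sₙ] ≅ B[t₁,…,tₙ]` implies `A ≅ B`. -/
def StronglyCancellative (k A : Type u) [Field k] [Ring A] [Algebra k A] : Prop :=
  ∀ (n : ℕ), 1 ≤ n → ∀ (B : Type u) [Ring B] [Algebra k B],
    Nonempty (PolyExt A n ≃ₐ[k] PolyExt B n) → Nonempty (A ≃ₐ[k] B)

/-- `A` is strongly Morita cancellative: for every `n ≥ 1` and every `k`-algebra `B`,
Morita equivalence of `A[s₁,…,sₙ]` and `B[t₁,…,tₙ]` implies Morita equivalence of `A` and `B`. -/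
def StronglyMoritaCancellative (k A : Type u) [Field k] [Ring A] [Algebra k A] : Prop :=
  ∀ (n : ℕ), 1 ≤ n → ∀ (B : Type u) [Ring B] [Algebra k B],
    MoritaEquivalent (PolyExt A n) (PolyExt B n) → MoritaEquivalent A B

/-- `A` is strongly retractable: every `k`-algebra isomorphism
`φ : A[s₁,…,sₙ] → B[t₁,…,tₙ]` (with `n ≥ 1`) satisfies `φ(A) = B`. -/
def StronglyRetractable (k A : Type u) [Field k] [Ring A] [Algebra k A] : Prop :=
  ∀ (n : ℕ), 1 ≤ n → ∀ (B : Type u) [Ring B] [Algebra k B]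
    (φ : PolyExt A n ≃ₐ[k] PolyExt B n),
    φ '' Set.range (PolyExt.C k A n) = Set.range (PolyExt.C k B n)

/-- `A` is strongly detectable: for every `k`-algebra isomorphism
`φ : A[s₁,…,sₙ] → B[t₁,…,tₙ]` (with `n ≥ 1`), the subalgebra of `B[t₁,…,tₙ]` generated by
`B` together with `φ(s₁),…,φ(sₙ)` is all of `B[t₁,…,tₙ]`. -/
def StronglyDetectable (k A : Type u) [Field k] [Ring A] [Algebra k A] : Prop :=
  ∀ (n : ℕ), 1 ≤ n → ∀ (B : Type u) [Ring B] [Algebra k B]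
    (φ : PolyExt A n ≃ₐ[k] PolyExt B n),
    Algebra.adjoin k
      (Set.range (PolyExt.C k B n) ∪ Set.range fun i => φ (PolyExt.X A n i)) = ⊤

/-- A surjective endomorphism of a Noetherian ring is injective. -/
theorem IsNoetherianRing.injective_of_surjective_ringHom {R : Type*} [CommRing R]
    [IsNoetherianRing R] (f : R →+* R) (hf : Function.Surjective f) : Function.Injective f := by
  let K : ℕ →o Ideal R :=
    { toFun n := RingHom.ker (f ^ n)
      monotone' := monotone_nat_of_le_succ fun n x hx => by
        rw [RingHom.mem_ker, RingHom.coe_pow] at hx ⊢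
        rw [Function.iterate_succ_apply', hx, map_zero] }
  obtain ⟨n, hn⟩ := monotone_stabilizes_iff_noetherian.2 ‹IsNoetherianRing R› K
  rw [injective_iff_map_eq_zero]
  intro x hx
  obtain ⟨y, rfl⟩ := hf.iterate n x
  have hy : y ∈ K n := by
    rw [hn (n + 1) n.le_succ]
    change (f ^ (n + 1)) y = 0
    rwa [RingHom.coe_pow, Function.iterate_succ_apply']
  rwa [← RingHom.coe_pow]

namespace MvPolynomial

/-- A surjective endomorphism of a polynomial algebra in finitely many variables over a
commutative ring is injective. -/
theorem injective_of_surjective_algHom {σ R : Type*} [Finite σ] [CommRing R]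
    (f : MvPolynomial σ R →ₐ[R] MvPolynomial σ R) (hf : Function.Surjective f) :
    Function.Injective f := by
  classical
  have := Fintype.ofFinite σ
  rw [injective_iff_map_eq_zero]
  intro p hp
  choose g hg using fun i => hf (X i)
  let T : Finset R := (Finset.univ.biUnion fun i => (f (X i)).coeffs) ∪
    (Finset.univ.biUnion fun i => (g i).coeffs) ∪ p.coeffs
  let S := Algebra.adjoin ℤ (T : Set R)
  have hS : IsNoetherianRing S := by
    have : Algebra.FiniteType ℤ S :=
      S.fg_iff_finiteType.1 (Subalgebra.fg_adjoin_finset T)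
    exact Algebra.FiniteType.isNoetherianRing ℤ S
  have lift (q : MvPolynomial σ R) (hq : q.coeffs ⊆ T) : ∃ q₀, map S.val.toRingHom q₀ = q := by
    refine mem_range_map_iff_coeffs_subset.2 fun r hr => ?_
    exact ⟨⟨r, Algebra.subset_adjoin (hq hr)⟩, rfl⟩
  have hinj : Function.Injective (map (σ := σ) S.val.toRingHom) :=
    map_injective _ Subtype.val_injective
  choose F hF using fun i => lift (f (X i)) fun r hr => by
    simp only [T, Finset.mem_union, Finset.mem_biUnion]
    exact .inl (.inl ⟨i, Finset.mem_univ i, hr⟩)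
  choose G hG using fun i => lift (g i) fun r hr => by
    simp only [T, Finset.mem_union, Finset.mem_biUnion]
    exact .inl (.inr ⟨i, Finset.mem_univ i, hr⟩)
  obtain ⟨P, hPp⟩ := lift p Finset.subset_union_right
  let f₀ : MvPolynomial σ S →ₐ[S] MvPolynomial σ S := aeval F
  have hcomm (q : MvPolynomial σ S) :
      map S.val.toRingHom (f₀ q) = f (map S.val.toRingHom q) := by
    induction q using MvPolynomial.induction_on with
    | C a =>
      simp only [f₀, aeval_C, algebraMap_eq, map_C]
      exact (f.commutes _).symm
    | add p q hp hq => simp only [map_add, hp, hq]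
    | mul_X p i hp => simp only [map_mul, hp, map_X, f₀, aeval_X, hF]
  have hsurj : Function.Surjective f₀ := by
    rw [← AlgHom.range_eq_top, eq_top_iff, ← adjoin_range_X, Algebra.adjoin_le_iff]
    rintro _ ⟨i, rfl⟩
    refine ⟨G i, hinj ?_⟩
    change map S.val.toRingHom (f₀ (G i)) = _
    rw [hcomm, hG, hg, map_X]
  have hP : P = 0 := by
    refine IsNoetherianRing.injective_of_surjective_ringHom f₀.toRingHom hsurj (hinj ?_)
    change map S.val.toRingHom (f₀ P) = map S.val.toRingHom (f₀ 0)
    rw [hcomm, hPp, hp, map_zero, map_zero]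
  rw [← hPp, hP, map_zero]

end MvPolynomial

namespace PolyExt

variable {k A : Type u} [Field k] [Ring A] [Algebra k A] {n : ℕ}

/-- Homomorphisms out of a polynomial extension are determined by their values on constants and
indeterminates. -/
theorem algHom_ext {D : Type u} [Ring D] [Algebra k D] {f g : PolyExt A n →ₐ[k] D}
    (hC : ∀ a, f (C k A n a) = g (C k A n a)) (hX : ∀ i, f (X A n i) = g (X A n i)) : f = g := by
  refine AddMonoidAlgebra.algHom_ext' ?_ (AlgHom.ext hC)
  ext i
  exact hX i

/-- Evaluation of polynomials at a tuple of central elements. -/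
noncomputable def eval (w : Fin n → Subalgebra.center k A) : PolyExt A n →ₐ[k] A :=
  AddMonoidAlgebra.liftNCAlgHom (AlgHom.id k A)
    (((Subalgebra.center k A).val.comp (MvPolynomial.aeval w) : _ →* A).comp
      (AddMonoidAlgebra.of k (Fin n →₀ ℕ)))
    fun a m => (Subalgebra.mem_center_iff.1
      (MvPolynomial.aeval w (AddMonoidAlgebra.of k (Fin n →₀ ℕ) m)).2 a)

@[simp]
theorem eval_C (w : Fin n → Subalgebra.center k A) (a : A) : eval w (C k A n a) = a := by
  refine (AddMonoidAlgebra.liftNC_single ..).trans ?_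
  simp [← AddMonoidAlgebra.one_def]

@[simp]
theorem eval_X (w : Fin n → Subalgebra.center k A) (i : Fin n) : eval w (X A n i) = w i := by
  have : MvPolynomial.aeval w (AddMonoidAlgebra.single (Finsupp.single i 1) (1 : k)) = w i :=
    MvPolynomial.aeval_X w i
  refine (AddMonoidAlgebra.liftNC_single ..).trans ?_
  simp [this]

theorem X_mem_center (i : Fin n) : X A n i ∈ Subalgebra.center k (PolyExt A n) := by
  rw [Subalgebra.mem_center_iff]
  intro p
  induction p using AddMonoidAlgebra.induction_linear with
  | zero => simp
  | add p q hp hq => rw [add_mul, mul_add, hp, hq]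
  | single m a => simp [X, AddMonoidAlgebra.single_mul_single, add_comm]

theorem C_mem_center {a : A} (ha : a ∈ Subalgebra.center k A) :
    C k A n a ∈ Subalgebra.center k (PolyExt A n) := by
  rw [Subalgebra.mem_center_iff] at ha ⊢
  intro p
  induction p using AddMonoidAlgebra.induction_linear with
  | zero => simp
  | add p q hp hq => rw [add_mul, mul_add, hp, hq]
  | single m b => simp [C, AddMonoidAlgebra.single_mul_single, ha]

/-- The inclusion of polynomials with central coefficients. -/
noncomputable def ofCenter (k A : Type u) [Field k] [Ring A] [Algebra k A] (n : ℕ) :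
    MvPolynomial (Fin n) (Subalgebra.center k A) →ₐ[k] PolyExt A n :=
  AddMonoidAlgebra.mapAlgHom _ (Subalgebra.center k A).val

theorem ofCenter_C (z : Subalgebra.center k A) :
    ofCenter k A n (MvPolynomial.C z) = C k A n z :=
  AddMonoidAlgebra.mapAlgHom_single ..

theorem ofCenter_X (i : Fin n) : ofCenter k A n (MvPolynomial.X i) = X A n i := by
  refine (AddMonoidAlgebra.mapAlgHom_single ..).trans ?_
  simp [X]

theorem ofCenter_injective : Function.Injective (ofCenter k A n) :=
  AddMonoidAlgebra.map_injective _ Subtype.val_injective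

theorem exists_ofCenter_eq {p : PolyExt A n} (hp : p ∈ Subalgebra.center k (PolyExt A n)) :
    ∃ q, ofCenter k A n q = p := by
  have hcoeff (m : Fin n →₀ ℕ) : p.coeff m ∈ Subalgebra.center k A := by
    rw [Subalgebra.mem_center_iff] at hp ⊢
    intro a
    have := congrArg (fun q : PolyExt A n => q.coeff m) (hp (C k A n a))
    change (AddMonoidAlgebra.single 0 a * p).coeff m = (p * AddMonoidAlgebra.single 0 a).coeff m
      at this
    rwa [AddMonoidAlgebra.coeff_single_zero_mul, AddMonoidAlgebra.coeff_mul_single_zero] at this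
  have : p ∈ Set.range (AddMonoidAlgebra.map
      ((Subalgebra.center k A).val.toRingHom : Subalgebra.center k A →+ A)) := by
    rw [AddMonoidAlgebra.range_map]
    exact fun m => ⟨⟨p.coeff m, hcoeff m⟩, rfl⟩
  exact this

theorem C_injective : Function.Injective (C k A n) :=
  Function.LeftInverse.injective (eval_C 0)

end PolyExt

/-- A surjective homomorphism sends central elements to central elements. -/
theorem AlgHom.map_mem_center {k A B : Type*} [CommSemiring k] [Semiring A] [Semiring B]
    [Algebra k A] [Algebra k B] (f : A →ₐ[k] B) (hf : Function.Surjective f) {a : A}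
    (ha : a ∈ Subalgebra.center k A) : f a ∈ Subalgebra.center k B := by
  rw [Subalgebra.mem_center_iff] at ha ⊢
  intro b
  obtain ⟨b, rfl⟩ := hf b
  rw [← map_mul, ha, map_mul]

/-- A surjective endomorphism of a polynomial extension that fixes the center of the coefficient
algebra is injective on the center. -/
theorem PolyExt.eq_zero_of_surjective {k A : Type u} [Field k] [Ring A] [Algebra k A] {n : ℕ}
    (f : PolyExt A n →ₐ[k] PolyExt A n) (hf : Function.Surjective f)
    (hC : ∀ z ∈ Subalgebra.center k A, f (C k A n z) = C k A n z)
    (hX : ∀ i, ∃ p ∈ Subalgebra.center k (PolyExt A n), f p = X A n i)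
    {p : PolyExt A n} (hp : p ∈ Subalgebra.center k (PolyExt A n)) (hfp : f p = 0) : p = 0 := by
  choose F hF using fun i => exists_ofCenter_eq (f.map_mem_center hf (X_mem_center (k := k) i))
  let f₀ : MvPolynomial (Fin n) (Subalgebra.center k A) →ₐ[Subalgebra.center k A]
    MvPolynomial (Fin n) (Subalgebra.center k A) := MvPolynomial.aeval F
  have hcomm (q : MvPolynomial (Fin n) (Subalgebra.center k A)) :
      ofCenter k A n (f₀ q) = f (ofCenter k A n q) := by
    induction q using MvPolynomial.induction_on with
    | C a => rw [ofCenter_C, hC _ a.2, MvPolynomial.aeval_C, MvPolynomial.algebraMap_eq, ofCenter_C]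
    | add p q hp hq => simp only [map_add, hp, hq]
    | mul_X p i hp => simp only [map_mul, hp, ofCenter_X, f₀, MvPolynomial.aeval_X, hF]
  have hsurj : Function.Surjective f₀ := by
    rw [← AlgHom.range_eq_top, eq_top_iff, ← MvPolynomial.adjoin_range_X, Algebra.adjoin_le_iff]
    rintro _ ⟨i, rfl⟩
    obtain ⟨q, hq, hqX⟩ := hX i
    obtain ⟨q, rfl⟩ := exists_ofCenter_eq hq
    refine ⟨q, ofCenter_injective ?_⟩
    change ofCenter k A n (f₀ q) = _
    rw [hcomm, hqX, ofCenter_X]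
  obtain ⟨q, rfl⟩ := exists_ofCenter_eq hp
  have hq : q = 0 := by
    refine MvPolynomial.injective_of_surjective_algHom f₀ hsurj (ofCenter_injective ?_)
    rw [hcomm, hfp, map_zero, map_zero]
  rw [hq, map_zero]

/-- If `φ : A[s₁,…,sₙ] → B[t₁,…,tₙ]` is a `k`-algebra isomorphism
with `φ(Z(A)) ⊆ B`, then `A ≅ B` as `k`-algebras. -/
theorem iso_of_image_of_center_subset
    (k A B : Type u) [Field k] [Ring A] [Ring B] [Algebra k A] [Algebra k B]
    (n : ℕ) (φ : PolyExt A n ≃ₐ[k] PolyExt B n)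
    (h : φ '' ((PolyExt.C k A n) '' (Subalgebra.center k A : Set A)) ⊆
      Set.range (PolyExt.C k B n)) :
    Nonempty (A ≃ₐ[k] B) := by
  let ε : PolyExt A n →ₐ[k] A := PolyExt.eval 0
  have hε (a : A) : ε (PolyExt.C k A n a) = a := PolyExt.eval_C 0 a
  let θ : B →ₐ[k] A := (ε.comp φ.symm.toAlgHom).comp (PolyExt.C k B n)
  have hθ (b : B) : θ b = ε (φ.symm (PolyExt.C k B n b)) := rfl
  have hcenter (z : A) (hz : z ∈ Subalgebra.center k A) :
      ∃ b : Subalgebra.center k B, PolyExt.C k B n b = φ (PolyExt.C k A n z) := by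
    obtain ⟨b, hb⟩ := h ⟨_, ⟨z, hz, rfl⟩, rfl⟩
    refine ⟨⟨b, Subalgebra.mem_center_iff.2 fun b' =>
      PolyExt.C_injective (k := k) (n := n) ?_⟩, hb⟩
    rw [map_mul, map_mul, hb]
    exact Subalgebra.mem_center_iff.1
      (φ.toAlgHom.map_mem_center φ.surjective (PolyExt.C_mem_center hz)) _
  choose w hw using fun i : Fin n => hcenter (ε (φ.symm (PolyExt.X B n i)))
    ((ε.comp φ.symm.toAlgHom).map_mem_center
      ((Function.LeftInverse.surjective hε).comp φ.symm.surjective) (PolyExt.X_mem_center i))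
  have hθw : θ.comp (PolyExt.eval w) = ε.comp φ.symm.toAlgHom := by
    refine PolyExt.algHom_ext (fun b => ?_) fun i => ?_
    · exact congrArg θ (PolyExt.eval_C w b)
    · change θ (PolyExt.eval w (PolyExt.X B n i)) = ε (φ.symm (PolyExt.X B n i))
      rw [PolyExt.eval_X, hθ, hw, φ.symm_apply_apply, hε]
  have hθw' (p : PolyExt B n) : θ (PolyExt.eval w p) = ε (φ.symm p) := DFunLike.congr_fun hθw p
  have hθ_surj : Function.Surjective θ := fun a =>
    ⟨PolyExt.eval w (φ (PolyExt.C k A n a)), by rw [hθw', φ.symm_apply_apply, hε]⟩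
  let Θ : PolyExt B n →ₐ[k] PolyExt A n := AddMonoidAlgebra.mapAlgHom _ θ
  have hΘ_C (b : B) : Θ (PolyExt.C k B n b) = PolyExt.C k A n (θ b) :=
    AddMonoidAlgebra.mapAlgHom_single ..
  have hΘ_X (i : Fin n) : Θ (PolyExt.X B n i) = PolyExt.X A n i := by
    refine (AddMonoidAlgebra.mapAlgHom_single ..).trans ?_
    rw [map_one, PolyExt.X]
  have hΘ_surj : Function.Surjective Θ := AddMonoidAlgebra.map_surjective _ hθ_surj
  have hθ_inj (b : B) (hb : b ∈ Subalgebra.center k B) (hb0 : θ b = 0) : b = 0 := by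
    have hC := PolyExt.C_mem_center (n := n) hb
    have := PolyExt.eq_zero_of_surjective (Θ.comp φ.toAlgHom) (hΘ_surj.comp φ.surjective)
      (p := φ.symm (PolyExt.C k B n b)) (fun z hz => ?_) (fun i => ?_)
      (φ.symm.toAlgHom.map_mem_center φ.symm.surjective hC) ?_
    · refine PolyExt.C_injective (k := k) (n := n) (φ.symm.injective ?_)
      rw [this, map_zero, map_zero]
    · obtain ⟨b, hb⟩ := hcenter z hz
      change Θ (φ _) = _
      rw [← hb, hΘ_C, hθ, hb, φ.symm_apply_apply, hε]
    · refine ⟨φ.symm (PolyExt.X B n i),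
        φ.symm.toAlgHom.map_mem_center φ.symm.surjective (PolyExt.X_mem_center i), ?_⟩
      change Θ (φ _) = _
      rw [φ.apply_symm_apply, hΘ_X]
    · change Θ (φ _) = _
      rw [φ.apply_symm_apply, hΘ_C, hb0, map_zero]
  let α : A →ₐ[k] B := ((PolyExt.eval w).comp φ.toAlgHom).comp (PolyExt.C k A n)
  have hα (a : A) : α a = PolyExt.eval w (φ (PolyExt.C k A n a)) := rfl
  have hαε : α.comp ε = (PolyExt.eval w).comp φ.toAlgHom := by
    refine PolyExt.algHom_ext (fun a => ?_) fun i => ?_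
    · exact congrArg α (hε a)
    · have hεX : ε (PolyExt.X A n i) = 0 := PolyExt.eval_X 0 i
      change α (ε (PolyExt.X A n i)) = PolyExt.eval w (φ (PolyExt.X A n i))
      rw [hεX, map_zero]
      refine (hθ_inj _ ?_ ?_).symm
      · exact ((PolyExt.eval w).comp φ.toAlgHom).map_mem_center
          ((Function.LeftInverse.surjective (PolyExt.eval_C w)).comp φ.surjective)
          (PolyExt.X_mem_center i)
      · rw [hθw', φ.symm_apply_apply, hεX]
  refine ⟨AlgEquiv.ofAlgHom α θ (AlgHom.ext fun b => ?_) (AlgHom.ext fun a => ?_)⟩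
  · have := DFunLike.congr_fun hαε (φ.symm (PolyExt.C k B n b))
    change α (ε _) = PolyExt.eval w (φ _) at this
    rwa [φ.apply_symm_apply, PolyExt.eval_C] at this
  · change θ (α a) = a
    rw [hα, hθw', φ.symm_apply_apply, hε]
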